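/- Let p ≥ 2. Then for all x ∈ (0, π_p/2), sin_p(x)/x < x/sinh_p(x); equivalently, sin_p(x)·sinh_p(x) < x². -/

import Mathlib

open Real Set Filter Topology

/-- Generalized inverse sine: `arcsin_p x = ∫₀ˣ (1 - tᵖ)^(-1/p) dt`. -/
noncomputable def arcsinp (p : ℝ) (x : ℝ) : ℝ := ∫ t in (0:ℝ)..x, (1 - t ^ p) ^ (-1 / p)

/-- Generalized π: `π_p = 2 · arcsin_p 1`. -/
noncomputable def pip (p : ℝ) : ℝ := 2 * arcsinp p 1

/-- Generalized sine: the inverse of `arcsinp p` (as a map from `[0,1]`). -/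
noncomputable def sinp (p : ℝ) : ℝ → ℝ := Function.invFunOn (arcsinp p) (Set.Icc 0 1)

/-- Generalized cosine. -/
noncomputable def cosp (p : ℝ) (x : ℝ) : ℝ := (1 - (sinp p x) ^ p) ^ (1 / p)

/-- Generalized tangent. -/
noncomputable def tanp (p : ℝ) (x : ℝ) : ℝ := sinp p x / cosp p x

/-- Generalized inverse hyperbolic sine: `arsinh_p x = ∫₀ˣ (1 + tᵖ)^(-1/p) dt`. -/
noncomputable def arsinhp (p : ℝ) (x : ℝ) : ℝ := ∫ t in (0:ℝ)..x, (1 + t ^ p) ^ (-1 / p)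

/-- Generalized hyperbolic sine: the inverse of `arsinhp p` (as a map from `[0,∞)`). -/
noncomputable def sinhp (p : ℝ) : ℝ → ℝ := Function.invFunOn (arsinhp p) (Set.Ici 0)

/-- Generalized hyperbolic cosine. -/
noncomputable def coshp (p : ℝ) (x : ℝ) : ℝ := (1 + (sinhp p x) ^ p) ^ (1 / p)

/-- Generalized hyperbolic tangent. -/
noncomputable def tanhp (p : ℝ) (x : ℝ) : ℝ := sinhp p x / coshp p x

lemma aux_pos {L K : ℝ} {φ d : ℝ → ℝ} (hd : ∀ x ∈ Ioo 0 L, HasDerivAt φ (d x) x)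
    (hpos : ∀ x ∈ Ioo 0 L, 0 < d x) (hK : ∀ x ∈ Ioo 0 L, -(K * x) ≤ φ x) :
    ∀ x ∈ Ioo 0 L, 0 < φ x := by
  intro x hx
  have hmono : StrictMonoOn φ (Ioo 0 L) := by
    apply strictMonoOn_of_deriv_pos (convex_Ioo 0 L)
    · intro y hy
      exact (hd y hy).continuousAt.continuousWithinAt
    · intro y hy
      rw [interior_Ioo] at hy
      rw [(hd y hy).deriv]
      exact hpos y hy
  have hx2 : x / 2 ∈ Ioo 0 L := ⟨by linarith [hx.1], by linarith [hx.1, hx.2]⟩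
  have h1 : φ (x / 2) < φ x := hmono hx2 hx (by linarith [hx.1])
  have h2 : 0 ≤ φ (x / 2) := by
    have ht : Tendsto (fun y : ℝ => -(K * y)) (𝓝[>] 0) (𝓝 0) := by
      have : Continuous (fun y : ℝ => -(K * y)) := by fun_prop
      have h := this.tendsto 0
      simp only [mul_zero, neg_zero] at h
      exact h.mono_left nhdsWithin_le_nhds
    apply le_of_tendsto ht
    filter_upwards [Ioo_mem_nhdsGT hx2.1] with y hy
    have hy' : y ∈ Ioo 0 L := ⟨hy.1, hy.2.trans hx2.2⟩
    exact (hK y hy').trans (hmono hy' hx2 hy.2).le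
  linarith

lemma aux_inv {F G f : ℝ → ℝ} {S T : Set ℝ} (hS : IsOpen S) (hT : IsOpen T)
    (hF : ∀ y ∈ S, HasDerivAt F (f y) y) (hmono : StrictMonoOn F S)
    (hG : ∀ x ∈ T, G x ∈ S ∧ F (G x) = x) (hFT : MapsTo F S T) {x : ℝ} (hx : x ∈ T)
    (hf : f (G x) ≠ 0) : HasDerivAt G (f (G x))⁻¹ x := by
  have hGm : MonotoneOn G T := by
    intro a ha b hb hab
    by_contra! h
    have := hmono (hG b hb).1 (hG a ha).1 h
    rw [(hG a ha).2, (hG b hb).2] at this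
    linarith
  have hc : ContinuousAt G x := by
    apply continuousAt_of_monotoneOn_of_image_mem_nhds hGm (hT.mem_nhds hx)
    apply mem_of_superset (hS.mem_nhds (hG x hx).1)
    intro y hy
    exact ⟨F y, hFT hy, hmono.injOn (hG _ (hFT hy)).1 hy (hG _ (hFT hy)).2⟩
  apply HasDerivAt.of_local_left_inverse hc (hF _ (hG x hx).1) hf
  filter_upwards [hT.mem_nhds hx] with y hy using (hG y hy).2

lemma aux_tan {p σ x : ℝ} {s : ℝ → ℝ} (hp : 2 ≤ p) (hs : 0 < s x) (hq : 0 < 1 + σ * s x ^ p)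
    (hd : HasDerivAt s ((1 + σ * s x ^ p) ^ (-1 / p))⁻¹ x) :
    HasDerivAt (fun y => s y * (1 + σ * s y ^ p) ^ (-1 / p))
      (1 - σ * (s x * (1 + σ * s x ^ p) ^ (-1 / p)) ^ p) x := by
  have hp0 : p ≠ 0 := by linarith
  have h1 := hd.rpow_const (p := p) (Or.inl hs.ne')
  have h2 := ((h1.const_mul σ).const_add 1).rpow_const (p := -1 / p) (Or.inl hq.ne')
  have h3 := hd.mul h2
  refine h3.congr_deriv ?_
  have hE : 0 < (1 + σ * s x ^ p) ^ (-1 / p) := rpow_pos_of_pos hq _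
  rw [mul_rpow hs.le hE.le, ← rpow_mul hq.le, div_mul_cancel₀ _ hp0, rpow_neg_one,
    rpow_sub_one hq.ne', rpow_sub_one hs.ne']
  have hsp : 0 < s x ^ p := rpow_pos_of_pos hs _
  generalize (1 + σ * s x ^ p) ^ (-1 / p) = E at *
  generalize s x ^ p = P at *
  field_simp
  ring

lemma aux_core {p L : ℝ} {s h : ℝ → ℝ} (hp : 2 ≤ p)
    (hs : ∀ x ∈ Ioo 0 L, 0 < s x) (hs1 : ∀ x ∈ Ioo 0 L, 0 < 1 - s x ^ p)
    (hsx : ∀ x ∈ Ioo 0 L, s x ≤ x)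
    (hh : ∀ x ∈ Ioo 0 L, 0 < h x) (hhx : ∀ x ∈ Ioo 0 L, h x ≤ x * exp x)
    (hsd : ∀ x ∈ Ioo 0 L, HasDerivAt s ((1 - s x ^ p) ^ (-1 / p))⁻¹ x)
    (hhd : ∀ x ∈ Ioo 0 L, HasDerivAt h ((1 + h x ^ p) ^ (-1 / p))⁻¹ x) :
    ∀ x ∈ Ioo 0 L, s x * h x < x ^ 2 := by
  have hp0 : 0 < p := by linarith
  obtain ⟨a, ha⟩ : ∃ a : ℝ → ℝ, a = fun y => s y * (1 - s y ^ p) ^ (-1 / p) := ⟨_, rfl⟩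
  obtain ⟨b, hb⟩ : ∃ b : ℝ → ℝ, b = fun y => h y * (1 + h y ^ p) ^ (-1 / p) := ⟨_, rfl⟩
  have hapos : ∀ x ∈ Ioo 0 L, 0 < a x := by
    intro x hx
    rw [ha]
    exact mul_pos (hs x hx) (rpow_pos_of_pos (hs1 x hx) _)
  have hh1 : ∀ x ∈ Ioo 0 L, 0 < 1 + h x ^ p := by
    intro x hx
    have := rpow_pos_of_pos (hh x hx) p
    linarith
  have hbpos : ∀ x ∈ Ioo 0 L, 0 < b x := by
    intro x hx
    rw [hb]
    exact mul_pos (hh x hx) (rpow_pos_of_pos (hh1 x hx) _)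
  have had : ∀ x ∈ Ioo 0 L, HasDerivAt a (1 + a x ^ p) x := by
    intro x hx
    have := aux_tan (p := p) (σ := -1) (s := s) (x := x) hp (hs x hx)
      (by have := hs1 x hx; linarith)
      (by simpa [sub_eq_add_neg] using hsd x hx)
    rw [ha]
    simpa [sub_eq_add_neg] using this
  have hbd : ∀ x ∈ Ioo 0 L, HasDerivAt b (1 - b x ^ p) x := by
    intro x hx
    have := aux_tan (p := p) (σ := 1) (s := h) (x := x) hp (hh x hx)
      (by have := hh1 x hx; linarith)
      (by simpa using hhd x hx)
    rw [hb]
    simpa using this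
  have hbh : ∀ x ∈ Ioo 0 L, b x ≤ h x := by
    intro x hx
    rw [hb]
    have h1 : (1 + h x ^ p) ^ (-1 / p) ≤ 1 := by
      apply rpow_le_one_of_one_le_of_nonpos
      · have := rpow_pos_of_pos (hh x hx) p
        linarith
      · apply div_nonpos_of_nonpos_of_nonneg <;> linarith
    have := hh x hx
    show h x * _ ≤ h x
    nlinarith
  -- a > x
  have hax : ∀ x ∈ Ioo 0 L, 0 < a x - x := by
    apply aux_pos (K := 1) (d := fun x => 1 + a x ^ p - 1)
    · intro x hx
      exact (had x hx).sub (hasDerivAt_id x)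
    · intro x hx
      have := rpow_pos_of_pos (hapos x hx) p
      simpa using this
    · intro x hx
      have := hapos x hx
      linarith
  have hbx : ∀ x ∈ Ioo 0 L, 0 < x - b x := by
    apply aux_pos (K := exp L) (d := fun x => 1 - (1 - b x ^ p))
    · intro x hx
      exact (hasDerivAt_id x).sub (hbd x hx)
    · intro x hx
      have := rpow_pos_of_pos (hbpos x hx) p
      simpa using this
    · intro x hx
      have h1 := hbh x hx
      have h2 := hhx x hx
      have h3 : exp x ≤ exp L := exp_le_exp.2 hx.2.le
      have := hx.1
      nlinarith
  have hw : ∀ x ∈ Ioo 0 L, 0 < ((a x)⁻¹ + (b x)⁻¹)⁻¹ - x / 2 := by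
    apply aux_pos (K := 1) (d := fun x => -(-(1 + a x ^ p) / a x ^ 2 + -(1 - b x ^ p) / b x ^ 2) /
        ((a x)⁻¹ + (b x)⁻¹) ^ 2 - 1 / 2)
    · intro x hx
      have hA := hapos x hx
      have hB := hbpos x hx
      have h1 := ((had x hx).inv hA.ne').add ((hbd x hx).inv hB.ne')
      have hne : (a x)⁻¹ + (b x)⁻¹ ≠ 0 := by positivity
      exact (h1.inv hne).sub ((hasDerivAt_id x).div_const 2)
    · intro x hx
      have hA := hapos x hx
      have hB := hbpos x hx
      have hlt : b x < a x := by linarith [hax x hx, hbx x hx]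
      have hle : b x ^ (p - 2) ≤ a x ^ (p - 2) := rpow_le_rpow hB.le hlt.le (by linarith)
      have e1 : a x ^ p = a x ^ (p - 2) * a x ^ 2 := by
        rw [← rpow_natCast, ← rpow_add hA]; norm_num
      have e2 : b x ^ p = b x ^ (p - 2) * b x ^ 2 := by
        rw [← rpow_natCast, ← rpow_add hB]; norm_num
      rw [e1, e2]
      have hinv : (a x)⁻¹ < (b x)⁻¹ := inv_strictAnti₀ hB hlt
      generalize a x ^ (p - 2) = P at *
      generalize b x ^ (p - 2) = Q at *
      have e3 : -(-(1 + P * a x ^ 2) / a x ^ 2 + -(1 - Q * b x ^ 2) / b x ^ 2)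
          = (a x)⁻¹ ^ 2 + (b x)⁻¹ ^ 2 + (P - Q) := by
        field_simp
        ring
      rw [e3, sub_pos, lt_div_iff₀ (by positivity)]
      have : 0 < ((b x)⁻¹ - (a x)⁻¹) ^ 2 := by
        have : 0 < (b x)⁻¹ - (a x)⁻¹ := by linarith
        positivity
      nlinarith
    · intro x hx
      have hA := hapos x hx
      have hB := hbpos x hx
      have : 0 < ((a x)⁻¹ + (b x)⁻¹)⁻¹ := by positivity
      linarith [hx.1]
  have hf : ∀ x ∈ Ioo 0 L, 0 < 2 * log x - log (s x) - log (h x) := by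
    apply aux_pos (K := 1) (d := fun x => 2 * x⁻¹ - ((1 - s x ^ p) ^ (-1 / p))⁻¹ / s x
      - ((1 + h x ^ p) ^ (-1 / p))⁻¹ / h x)
    · intro x hx
      exact (((hasDerivAt_log hx.1.ne').const_mul 2).sub ((hsd x hx).log (hs x hx).ne')).sub
        ((hhd x hx).log (hh x hx).ne')
    · intro x hx
      have hA := hapos x hx
      have hB := hbpos x hx
      have e1 : ((1 - s x ^ p) ^ (-1 / p))⁻¹ / s x = (a x)⁻¹ := by
        rw [ha]; simp only [mul_inv]; rw [mul_comm]; rfl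
      have e2 : ((1 + h x ^ p) ^ (-1 / p))⁻¹ / h x = (b x)⁻¹ := by
        rw [hb]; simp only [mul_inv]; rw [mul_comm]; rfl
      rw [e1, e2]
      have h1 := hw x hx
      have h2 : x / 2 < ((a x)⁻¹ + (b x)⁻¹)⁻¹ := by linarith
      have h3 := (lt_inv_comm₀ (by linarith [hx.1]) (by positivity)).1 h2
      rw [inv_div] at h3
      rw [← div_eq_mul_inv]
      linarith
    · intro x hx
      have h1 : log (s x) ≤ log x := log_le_log (hs x hx) (hsx x hx)
      have h2 : log (h x) ≤ log x + x := by
        have := log_le_log (hh x hx) (hhx x hx)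
        rwa [log_mul hx.1.ne' (exp_pos _).ne', log_exp] at this
      linarith
  intro x hx
  have h1 := hf x hx
  have h2 : log (s x * h x) < log (x ^ 2) := by
    rw [log_mul (hs x hx).ne' (hh x hx).ne', log_pow]
    push_cast
    linarith
  exact (log_lt_log_iff (mul_pos (hs x hx) (hh x hx)) (pow_pos hx.1 2)).1 h2

lemma one_sub_pos {p t : ℝ} (hp : 2 ≤ p) (h0 : 0 ≤ t) (h1 : t < 1) : 0 < 1 - t ^ p := by
  have := rpow_lt_one h0 h1 (by linarith : 0 < p)
  linarith

lemma arcsinp_hasDerivAt {p y : ℝ} (hp : 2 ≤ p) (hy : y ∈ Ioo (0:ℝ) 1) :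
    HasDerivAt (arcsinp p) ((1 - y ^ p) ^ (-1 / p)) y := by
  have hp0 : 0 ≤ p := by linarith
  have hc : ∀ t ∈ Ico (0:ℝ) 1, ContinuousAt (fun t : ℝ => (1 - t ^ p) ^ (-1 / p)) t := by
    intro t ht
    have h1 : ContinuousAt (fun t : ℝ => 1 - t ^ p) t :=
      continuousAt_const.sub (continuousAt_id.rpow_const (Or.inr hp0))
    exact h1.rpow_const (Or.inl (one_sub_pos hp ht.1 ht.2).ne')
  apply intervalIntegral.integral_hasDerivAt_right
  · apply ContinuousOn.intervalIntegrable
    rw [uIcc_of_le hy.1.le]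
    intro t ht
    exact (hc t ⟨ht.1, ht.2.trans_lt hy.2⟩).continuousWithinAt
  · have : Measurable (fun t : ℝ => (1 - t ^ p) ^ (-1 / p)) := by fun_prop
    exact this.stronglyMeasurable.stronglyMeasurableAtFilter
  · exact hc y ⟨hy.1.le, hy.2⟩

lemma arsinhp_hasDerivAt {p y : ℝ} (hp : 2 ≤ p) (hy : 0 ≤ y) :
    HasDerivAt (arsinhp p) ((1 + y ^ p) ^ (-1 / p)) y := by
  have hp0 : 0 ≤ p := by linarith
  have hc : ∀ t, 0 ≤ t → ContinuousAt (fun t : ℝ => (1 + t ^ p) ^ (-1 / p)) t := by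
    intro t ht
    have h1 : ContinuousAt (fun t : ℝ => 1 + t ^ p) t :=
      continuousAt_const.add (continuousAt_id.rpow_const (Or.inr hp0))
    exact h1.rpow_const (Or.inl (by have := rpow_nonneg ht p; positivity))
  apply intervalIntegral.integral_hasDerivAt_right
  · apply ContinuousOn.intervalIntegrable
    rw [uIcc_of_le hy]
    intro t ht
    exact (hc t ht.1).continuousWithinAt
  · have : Measurable (fun t : ℝ => (1 + t ^ p) ^ (-1 / p)) := by fun_prop
    exact this.stronglyMeasurable.stronglyMeasurableAtFilter
  · exact hc y hy

lemma arsinhp_zero (p : ℝ) : arsinhp p 0 = 0 := by simp [arsinhp]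

lemma arcsinp_zero (p : ℝ) : arcsinp p 0 = 0 := by simp [arcsinp]

lemma arsinhp_strictMonoOn {p : ℝ} (hp : 2 ≤ p) : StrictMonoOn (arsinhp p) (Ici 0) := by
  apply strictMonoOn_of_deriv_pos (convex_Ici 0)
  · intro y hy
    exact (arsinhp_hasDerivAt hp hy).continuousAt.continuousWithinAt
  · intro y hy
    rw [interior_Ici] at hy
    rw [(arsinhp_hasDerivAt hp (le_of_lt hy)).deriv]
    have := rpow_pos_of_pos hy p
    positivity

lemma log_le_arsinhp {p y : ℝ} (hp : 2 ≤ p) (hy : 0 ≤ y) : log (1 + y) ≤ arsinhp p y := by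
  have hd : ∀ t : ℝ, 0 ≤ t → HasDerivAt (fun t => arsinhp p t - log (1 + t))
      ((1 + t ^ p) ^ (-1 / p) - 1 / (1 + t)) t := by
    intro t ht
    exact (arsinhp_hasDerivAt hp ht).sub
      (((hasDerivAt_id t).const_add 1).log (by simp only [id]; positivity))
  have hm : MonotoneOn (fun t => arsinhp p t - log (1 + t)) (Ici 0) := by
    apply monotoneOn_of_deriv_nonneg (convex_Ici 0)
    · intro t ht
      exact (hd t ht).continuousAt.continuousWithinAt
    · intro t ht
      rw [interior_Ici] at ht
      exact (hd t (le_of_lt ht)).differentiableAt.differentiableWithinAt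
    · intro t ht
      rw [interior_Ici] at ht
      have ht' : 0 < t := ht
      rw [(hd t ht'.le).deriv, sub_nonneg]
      have h1 : 1 + t ^ p ≤ (1 + t) ^ p := by
        have := add_rpow_le_rpow_add (zero_le_one) ht'.le (by linarith : 1 ≤ p)
        simpa using this
      have h0 : 0 < 1 + t ^ p := by have := rpow_pos_of_pos ht' p; positivity
      have h2 : ((1 + t) ^ p) ^ (-1 / p) ≤ (1 + t ^ p) ^ (-1 / p) :=
        rpow_le_rpow_of_nonpos h0 h1
          (div_nonpos_of_nonpos_of_nonneg (by norm_num) (by linarith))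
      rw [← rpow_mul (by positivity), mul_div_cancel₀ _ (by linarith : p ≠ 0), rpow_neg_one] at h2
      rw [one_div]
      exact h2
  have := hm (self_mem_Ici) (show y ∈ Ici 0 from hy) hy
  simp [arsinhp_zero] at this
  exact this

lemma sinhp_spec {p x : ℝ} (hp : 2 ≤ p) (hx : 0 < x) :
    0 < sinhp p x ∧ arsinhp p (sinhp p x) = x := by
  have hex : ∃ y ∈ Ici (0:ℝ), arsinhp p y = x := by
    have hE : 0 ≤ exp x := (exp_pos x).le
    have hc : ContinuousOn (arsinhp p) (Icc 0 (exp x)) := fun y hy =>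
      (arsinhp_hasDerivAt hp hy.1).continuousAt.continuousWithinAt
    have := intermediate_value_Icc hE hc
    have hxm : x ∈ Icc (arsinhp p 0) (arsinhp p (exp x)) := by
      rw [arsinhp_zero]
      refine ⟨hx.le, ?_⟩
      refine le_trans ?_ (log_le_arsinhp hp hE)
      rw [le_log_iff_exp_le (by positivity)]
      linarith
    obtain ⟨y, hy, h⟩ := this hxm
    exact ⟨y, hy.1, h⟩
  have h1 : sinhp p x ∈ Ici (0:ℝ) := Function.invFunOn_mem hex
  have h2 : arsinhp p (sinhp p x) = x := Function.invFunOn_eq hex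
  refine ⟨lt_of_le_of_ne h1 ?_, h2⟩
  intro h
  rw [← h, arsinhp_zero] at h2
  linarith

lemma arcsinp_continuousOn {p : ℝ} (hL : 0 < arcsinp p 1) :
    ContinuousOn (arcsinp p) (Icc 0 1) := by
  have hi : IntervalIntegrable (fun t : ℝ => (1 - t ^ p) ^ (-1 / p)) MeasureTheory.volume 0 1 := by
    by_contra h
    have := intervalIntegral.integral_undef h
    unfold arcsinp at hL
    linarith
  have := intervalIntegral.continuousOn_primitive_interval
    (f := fun t : ℝ => (1 - t ^ p) ^ (-1 / p)) (a := 0) (b := 1) (μ := MeasureTheory.volume)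
    (by rw [uIcc_of_le zero_le_one]
        exact (intervalIntegrable_iff_integrableOn_Icc_of_le zero_le_one).1 hi)
  rw [uIcc_of_le zero_le_one] at this
  exact this

lemma arcsinp_strictMonoOn {p : ℝ} (hp : 2 ≤ p) (hL : 0 < arcsinp p 1) :
    StrictMonoOn (arcsinp p) (Icc 0 1) := by
  apply strictMonoOn_of_deriv_pos (convex_Icc 0 1) (arcsinp_continuousOn hL)
  intro y hy
  rw [interior_Icc] at hy
  rw [(arcsinp_hasDerivAt hp hy).deriv]
  exact rpow_pos_of_pos (one_sub_pos hp hy.1.le hy.2) _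

lemma le_arcsinp {p y : ℝ} (hp : 2 ≤ p) (hL : 0 < arcsinp p 1) (hy : y ∈ Icc (0:ℝ) 1) :
    y ≤ arcsinp p y := by
  have hd : ∀ t ∈ Ioo (0:ℝ) 1, HasDerivAt (fun t => arcsinp p t - t)
      ((1 - t ^ p) ^ (-1 / p) - 1) t := fun t ht =>
    (arcsinp_hasDerivAt hp ht).sub (hasDerivAt_id t)
  have hm : MonotoneOn (fun t => arcsinp p t - t) (Icc 0 1) := by
    apply monotoneOn_of_deriv_nonneg (convex_Icc 0 1)
    · exact (arcsinp_continuousOn hL).sub continuousOn_id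
    · intro t ht
      rw [interior_Icc] at ht
      exact (hd t ht).differentiableAt.differentiableWithinAt
    · intro t ht
      rw [interior_Icc] at ht
      rw [(hd t ht).deriv, sub_nonneg]
      apply one_le_rpow_of_pos_of_le_one_of_nonpos (one_sub_pos hp ht.1.le ht.2)
      · have := rpow_pos_of_pos ht.1 p
        linarith
      · exact div_nonpos_of_nonpos_of_nonneg (by norm_num) (by linarith)
  have := hm (left_mem_Icc.2 zero_le_one) hy hy.1
  simp [arcsinp_zero] at this
  exact this

lemma sinp_spec {p x : ℝ} (hL : 0 < arcsinp p 1) (hx : x ∈ Ioo 0 (arcsinp p 1)) :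
    sinp p x ∈ Ioo (0:ℝ) 1 ∧ arcsinp p (sinp p x) = x := by
  have hex : ∃ y ∈ Icc (0:ℝ) 1, arcsinp p y = x := by
    have := intermediate_value_Icc zero_le_one (arcsinp_continuousOn hL)
    apply this
    rw [arcsinp_zero]
    exact ⟨hx.1.le, hx.2.le⟩
  have h1 : sinp p x ∈ Icc (0:ℝ) 1 := Function.invFunOn_mem hex
  have h2 : arcsinp p (sinp p x) = x := Function.invFunOn_eq hex
  refine ⟨⟨lt_of_le_of_ne h1.1 ?_, lt_of_le_of_ne h1.2 ?_⟩, h2⟩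
  · intro h
    rw [← h, arcsinp_zero] at h2
    linarith [hx.1]
  · intro h
    rw [h] at h2
    linarith [hx.2]

theorem stmt2 (p : ℝ) (hp : 2 ≤ p) :
    ∀ x ∈ Set.Ioo 0 (pip p / 2),
      sinp p x / x < x / sinhp p x ∧ sinp p x * sinhp p x < x ^ 2 := by
  intro x hx
  have hpip : pip p / 2 = arcsinp p 1 := by unfold pip; ring
  rw [hpip] at hx
  have hL : 0 < arcsinp p 1 := hx.1.trans hx.2
  have hs := fun y (hy : y ∈ Ioo 0 (arcsinp p 1)) => sinp_spec hL hy
  have hh := fun y (hy : y ∈ Ioo 0 (arcsinp p 1)) => sinhp_spec hp hy.1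
  have hmS := arcsinp_strictMonoOn hp hL
  have hmH := arsinhp_strictMonoOn hp
  have key : sinp p x * sinhp p x < x ^ 2 := by
    apply aux_core (L := arcsinp p 1) hp (fun y hy => (hs y hy).1.1)
      (fun y hy => one_sub_pos hp (hs y hy).1.1.le (hs y hy).1.2) _
      (fun y hy => (hh y hy).1) _ _ _ x hx
    · intro y hy
      have := le_arcsinp hp hL (Ioo_subset_Icc_self (hs y hy).1)
      rwa [(hs y hy).2] at this
    · intro y hy
      have h1 := log_le_arsinhp hp (hh y hy).1.le
      rw [(hh y hy).2, log_le_iff_le_exp (by linarith [(hh y hy).1])] at h1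
      have h2 := add_one_le_exp (-y)
      have h3 : exp (-y) * exp y = 1 := by rw [← exp_add]; simp
      have h4 := exp_pos y
      nlinarith
    · intro y hy
      apply aux_inv (F := arcsinp p) (f := fun t => (1 - t ^ p) ^ (-1 / p)) isOpen_Ioo isOpen_Ioo
        (fun t ht => arcsinp_hasDerivAt hp ht) (hmS.mono Ioo_subset_Icc_self) hs _ hy
      · exact (rpow_pos_of_pos (one_sub_pos hp (hs y hy).1.1.le (hs y hy).1.2) _).ne'
      · intro t ht
        refine ⟨?_, hmS (Ioo_subset_Icc_self ht) (right_mem_Icc.2 zero_le_one) ht.2⟩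
        have := hmS (left_mem_Icc.2 zero_le_one) (Ioo_subset_Icc_self ht) ht.1
        rwa [arcsinp_zero] at this
    · intro y hy
      apply aux_inv (F := arsinhp p) (f := fun t => (1 + t ^ p) ^ (-1 / p)) isOpen_Ioi isOpen_Ioi
        (S := Ioi 0) (T := Ioi 0)
        (fun t ht => arsinhp_hasDerivAt hp (le_of_lt ht)) (hmH.mono Ioi_subset_Ici_self)
        (fun t ht => sinhp_spec hp ht) _ hy.1
      · have := rpow_pos_of_pos (hh y hy).1 p
        positivity
      · intro t ht
        have := hmH self_mem_Ici (Ioi_subset_Ici_self ht) ht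
        rwa [arsinhp_zero] at this
  refine ⟨?_, key⟩
  rw [div_lt_div_iff₀ hx.1 (hh x hx).1]
  linarith [pow_two x]
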